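/- Let p be a weight sequence of tubular type and H(p) = Z(3x⃗_1) ⊕ Zω⃗ the subgroup of L(p) generated by 3x⃗_1 and ω⃗, with positive cone H(p)_+ = H(p) ∩ L(p)_+. Then H(p)_+ is generated as a monoid by the finite subset (3x⃗_1 + Zω⃗) ∩ H(p)_+, i.e. H(p)_+ = N((3x⃗_1 + Zω⃗) ∩ H(p)_+). -/

import Mathlib

/-- The relations `p i • x⃗ᵢ = p 0 • x⃗₀` defining the string group `L(p)`. -/
def stringRel (t : ℕ) (p : Fin t → ℕ) : AddSubgroup (FreeAbelianGroup (Fin t)) :=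
  AddSubgroup.closure
    { v | ∃ (i : Fin t) (h0 : 0 < t),
        v = (p i : ℤ) • FreeAbelianGroup.of i -
          (p ⟨0, h0⟩ : ℤ) • FreeAbelianGroup.of ⟨0, h0⟩ }

/-- The string group `L(p)` of a weight sequence `p`: the abelian group generated by
`x⃗₁, …, x⃗ₜ` subject to `p₁ x⃗₁ = ⋯ = p_t x⃗_t =: c⃗`. -/
def StringGroup (t : ℕ) (p : Fin t → ℕ) : Type :=
  FreeAbelianGroup (Fin t) ⧸ stringRel t p

instance (t : ℕ) (p : Fin t → ℕ) : AddCommGroup (StringGroup t p) :=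
  inferInstanceAs (AddCommGroup (FreeAbelianGroup (Fin t) ⧸ stringRel t p))

/-- The generator `x⃗ᵢ` of the string group. -/
def strGen (t : ℕ) (p : Fin t → ℕ) (i : Fin t) : StringGroup t p :=
  QuotientAddGroup.mk (FreeAbelianGroup.of i)

/-- The canonical element `c⃗ = pᵢ x⃗ᵢ` of the string group. -/
def strCan (t : ℕ) (p : Fin t → ℕ) (h0 : 0 < t) : StringGroup t p :=
  (p ⟨0, h0⟩ : ℤ) • strGen t p ⟨0, h0⟩

/-- The dualizing element `ω⃗ = (t-2) c⃗ - ∑ᵢ x⃗ᵢ` of the string group. -/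
def strDual (t : ℕ) (p : Fin t → ℕ) (h0 : 0 < t) : StringGroup t p :=
  ((t : ℤ) - 2) • strCan t p h0 - ∑ i : Fin t, strGen t p i

lemma str_hom (t : ℕ) (p : Fin t → ℕ) (h0 : 0 < t) {A : Type} [AddCommGroup A] (g : Fin t → A)
    (hg : ∀ i, (p i : ℤ) • g i = (p ⟨0, h0⟩ : ℤ) • g ⟨0, h0⟩) :
    ∃ f : StringGroup t p →+ A, ∀ i, f (strGen t p i) = g i := by
  refine ⟨QuotientAddGroup.lift (stringRel t p) (FreeAbelianGroup.lift g) ?_, ?_⟩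
  · unfold stringRel
    rw [AddSubgroup.closure_le]
    rintro v ⟨i, h, rfl⟩
    simp only [SetLike.mem_coe, AddMonoidHom.mem_ker, map_sub, map_zsmul,
      FreeAbelianGroup.lift_apply_of]
    rw [hg i, sub_self]
  · intro i
    exact FreeAbelianGroup.lift_apply_of g i

lemma str_rel (t : ℕ) (p : Fin t → ℕ) (h0 : 0 < t) (i : Fin t) :
    (p i : ℤ) • strGen t p i = (p ⟨0, h0⟩ : ℤ) • strGen t p ⟨0, h0⟩ := by
  have : (p i : ℤ) • FreeAbelianGroup.of i -
      (p ⟨0, h0⟩ : ℤ) • FreeAbelianGroup.of (⟨0, h0⟩ : Fin t) ∈ stringRel t p :=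
    AddSubgroup.subset_closure ⟨i, h0, rfl⟩
  rw [← sub_eq_zero]
  exact (QuotientAddGroup.eq_zero_iff _).2 this

lemma str_deg (t : ℕ) (p : Fin t → ℕ) (h0 : 0 < t) (hw : ∀ i, 2 ≤ p i) :
    ∃ f : StringGroup t p →+ ℚ, (∀ i, f (strGen t p i) = 1 / (p i : ℚ)) ∧
      f (strDual t p h0) = (t : ℚ) - 2 - ∑ i, 1 / (p i : ℚ) := by
  have hne : ∀ i, (p i : ℚ) ≠ 0 := fun i => by
    have := hw i
    positivity
  obtain ⟨f, hf⟩ := str_hom t p h0 (fun i => 1 / (p i : ℚ)) (fun i => by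
    have h1 := hne i
    have h2 := hne ⟨0, h0⟩
    simp only [zsmul_eq_mul, Int.cast_natCast]
    field_simp)
  refine ⟨f, hf, ?_⟩
  have h2 := hne ⟨0, h0⟩
  simp only [strDual, strCan, map_sub, map_zsmul, map_sum, hf, zsmul_eq_mul]
  push_cast
  field_simp

lemma str_key (t : ℕ) (p : Fin t → ℕ) (h0 : 0 < t) (hw : ∀ i, 2 ≤ p i)
    (hdeg : ∑ i, 1 / (p i : ℚ) = (t : ℚ) - 2) (n : Fin t → ℕ) (a j : ℤ)
    (h : ∑ i, n i • strGen t p i = a • ((3 : ℤ) • strGen t p ⟨0, h0⟩) + j • strDual t p h0) :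
    (∑ i, (n i : ℚ) * (1 / (p i : ℚ)) = 3 * a * (1 / (p ⟨0, h0⟩ : ℚ))) ∧
    ∀ i, ∃ k : ℤ, (n i : ℤ) = (if i = ⟨0, h0⟩ then 3 * a else 0) - j + p i * k := by
  constructor
  · obtain ⟨f, hf, hd⟩ := str_deg t p h0 hw
    have := congrArg f h
    simp only [map_sum, map_nsmul, map_add, map_zsmul, hf, hd, hdeg] at this
    simp only [nsmul_eq_mul, zsmul_eq_mul] at this
    rw [this]
    push_cast
    ring
  · intro i
    obtain ⟨f, hf⟩ := str_hom t p h0 (A := ZMod (p i)) (fun l => if l = i then 1 else 0) (by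
      have key : ∀ l, (p l : ℤ) • (if l = i then (1 : ZMod (p i)) else 0) = 0 := by
        intro l
        split_ifs with hl
        · subst hl
          simp
        · simp
      intro l
      rw [key, key])
    have hc : f (strCan t p h0) = 0 := by
      rw [strCan, ← str_rel t p h0 i, map_zsmul, hf]
      simp
    have hd : f (strDual t p h0) = -1 := by
      rw [strDual, map_sub, map_zsmul, hc, map_sum]
      simp [hf]
    have := congrArg f h
    simp only [map_sum, map_nsmul, map_add, map_zsmul, hf, hd] at this
    have h2 : ((n i : ℤ) : ZMod (p i)) =
        (((if i = ⟨0, h0⟩ then 3 * a else 0) - j : ℤ) : ZMod (p i)) := by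
      simp only [smul_ite, nsmul_eq_mul, mul_one, mul_zero, Finset.sum_ite_eq', Finset.mem_univ,
        if_true, zsmul_eq_mul] at this
      push_cast
      rw [this]
      by_cases hi : i = ⟨0, h0⟩
      · simp [hi]
        ring
      · have hi' : ¬ (⟨0, h0⟩ = i) := fun e => hi e.symm
        simp [hi, hi']
    rw [ZMod.intCast_eq_intCast_iff_dvd_sub] at h2
    obtain ⟨k, hk⟩ := h2
    exact ⟨-k, by linarith⟩

lemma str_final (t : ℕ) (p : Fin t → ℕ) (h0 : 0 < t) (hw : ∀ i, 2 ≤ p i)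
    (hdeg : ∑ i, 1 / (p i : ℚ) = (t : ℚ) - 2) (N : ℤ)
    (hN : N • strDual t p h0 = 0)
    (h2 : (3 : ℤ) • strGen t p ⟨0, h0⟩ + (2 : ℤ) • strDual t p h0 ∈
      AddSubmonoid.closure (Set.range (strGen t p)))
    (h3 : (3 : ℤ) • strGen t p ⟨0, h0⟩ + (3 : ℤ) • strDual t p h0 ∈
      AddSubmonoid.closure (Set.range (strGen t p)))
    (hex : ∀ (n : Fin t → ℕ) (a j : ℤ),
      (∑ i, (n i : ℚ) * (1 / (p i : ℚ)) = 3 * a * (1 / (p ⟨0, h0⟩ : ℚ))) →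
      (∀ i, ∃ k : ℤ, (n i : ℤ) = (if i = ⟨0, h0⟩ then 3 * a else 0) - j + p i * k) →
      ∃ β γ : ℕ, (β + γ : ℤ) ≤ a ∧ ∃ k, j = 2 * β + 3 * γ + N * k) :
    { v : StringGroup t p |
        v ∈ AddSubgroup.closure
          {(3 : ℤ) • strGen t p ⟨0, h0⟩, strDual t p h0} ∧
        v ∈ AddSubmonoid.closure (Set.range (strGen t p)) } =
      ↑(AddSubmonoid.closure
        { w : StringGroup t p |
            (∃ j : ℤ, w = (3 : ℤ) • strGen t p ⟨0, h0⟩ + j • strDual t p h0) ∧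
            w ∈ AddSubmonoid.closure (Set.range (strGen t p)) }) := by
  ext v
  simp only [Set.mem_ofPred_eq, SetLike.mem_coe]
  constructor
  · rintro ⟨hv, hpos⟩
    obtain ⟨a, j, haj⟩ := AddSubgroup.mem_closure_pair.1 hv
    have hn : ∃ n : Fin t → ℕ, ∑ i, n i • strGen t p i = v := by
      clear hv haj
      induction hpos using AddSubmonoid.closure_induction with
      | mem x hx =>
        obtain ⟨i, rfl⟩ := hx
        exact ⟨Pi.single i 1, by simp [Pi.single_apply]⟩
      | zero => exact ⟨0, by simp⟩
      | add x y _ _ hx hy =>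
        obtain ⟨m, rfl⟩ := hx
        obtain ⟨m', rfl⟩ := hy
        exact ⟨m + m', by simp [add_smul, Finset.sum_add_distrib]⟩
    obtain ⟨n, hn⟩ := hn
    obtain ⟨e1, e2⟩ := str_key t p h0 hw hdeg n a j (hn.trans haj.symm)
    obtain ⟨β, γ, hle, k, hk⟩ := hex n a j e1 e2
    obtain ⟨α, hα⟩ := Int.eq_ofNat_of_zero_le (sub_nonneg.2 hle)
    have ha : a = α + β + γ := by linarith
    have hu : (3 : ℤ) • strGen t p ⟨0, h0⟩ + (0 : ℤ) • strDual t p h0 ∈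
        AddSubmonoid.closure (Set.range (strGen t p)) := by
      have : (3 : ℤ) • strGen t p ⟨0, h0⟩ + (0 : ℤ) • strDual t p h0
        = 3 • strGen t p ⟨0, h0⟩ := by module
      rw [this]
      exact nsmul_mem (AddSubmonoid.subset_closure (Set.mem_range_self _)) _
    have : v = α • ((3 : ℤ) • strGen t p ⟨0, h0⟩ + (0 : ℤ) • strDual t p h0)
        + β • ((3 : ℤ) • strGen t p ⟨0, h0⟩ + (2 : ℤ) • strDual t p h0)
        + γ • ((3 : ℤ) • strGen t p ⟨0, h0⟩ + (3 : ℤ) • strDual t p h0) := by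
      rw [← haj, hk, ha]
      linear_combination (norm := module) k • hN
    rw [this]
    refine add_mem (add_mem ?_ ?_) ?_
    · exact nsmul_mem (AddSubmonoid.subset_closure (Set.mem_ofPred_eq ▸ ⟨⟨0, rfl⟩, hu⟩)) _
    · exact nsmul_mem (AddSubmonoid.subset_closure (Set.mem_ofPred_eq ▸ ⟨⟨2, rfl⟩, h2⟩)) _
    · exact nsmul_mem (AddSubmonoid.subset_closure (Set.mem_ofPred_eq ▸ ⟨⟨3, rfl⟩, h3⟩)) _
  · intro hv
    induction hv using AddSubmonoid.closure_induction with
    | mem x hx =>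
      obtain ⟨⟨j, hj⟩, hx⟩ := hx
      refine ⟨AddSubgroup.mem_closure_pair.2 ⟨1, j, ?_⟩, hx⟩
      rw [hj, one_smul]
    | zero => exact ⟨zero_mem _, zero_mem _⟩
    | add x y _ _ hx hy => exact ⟨add_mem hx.1 hy.1, add_mem hx.2 hy.2⟩

lemma str_arith3 (a b c : ℕ) (hc : 2 ≤ c) (hbc : c ≤ b) (hab : b ≤ a)
    (h : 1 / (a : ℚ) + 1 / (b : ℚ) + 1 / (c : ℚ) = 1) :
    (a = 3 ∧ b = 3 ∧ c = 3) ∨ (a = 4 ∧ b = 4 ∧ c = 2) ∨ (a = 6 ∧ b = 3 ∧ c = 2) := by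
  have h1 : (b * c + a * c + a * b : ℕ) = a * b * c := by
    have ha : (a : ℚ) ≠ 0 := by
      have : 0 < a := by omega
      positivity
    have hb : (b : ℚ) ≠ 0 := by
      have : 0 < b := by omega
      positivity
    have hc : (c : ℚ) ≠ 0 := by positivity
    field_simp at h
    have : ((b * c + a * c + a * b : ℕ) : ℚ) = ((a * b * c : ℕ) : ℚ) := by
      push_cast
      linarith
    exact_mod_cast this
  have hc3 : c ≤ 3 := by
    by_contra! hc4
    have e1 : b * c ≤ a * b := by nlinarith
    have e2 : a * c ≤ a * b := by nlinarith
    have e3 : a * b * 4 ≤ a * b * c := Nat.mul_le_mul_left _ hc4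
    have : 0 < a * b := Nat.mul_pos (by omega) (by omega)
    omega
  interval_cases c
  · have hb4 : b ≤ 4 := by
      by_contra! hb
      have : a * 5 ≤ a * b := Nat.mul_le_mul_left _ hb
      nlinarith
    interval_cases b <;> omega
  · have hb3 : b ≤ 3 := by
      by_contra! hb
      have : a * 4 ≤ a * b := Nat.mul_le_mul_left _ hb
      nlinarith
    interval_cases b
    omega

/-- **Generators of the positive cone of `H(p) = ℤ(3x⃗₁) ⊕ ℤω⃗` in tubular type.**
Let `p` be a weight sequence of tubular type and `H(p) ⊆ L(p)` the subgroup generated by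
`3x⃗₁` and `ω⃗`, with positive cone `H(p)₊ = H(p) ∩ L(p)₊` (where `L(p)₊` is the submonoid
generated by `x⃗₁, …, x⃗ₜ`).  Then `H(p)₊` is generated as a monoid by the subset
`(3x⃗₁ + ℤω⃗) ∩ H(p)₊`. -/
theorem tubular_positive_cone_generators
    (t : ℕ) (p : Fin t → ℕ) (h0 : 0 < t)
    (hw : ∀ i, 2 ≤ p i) (hsorted : ∀ i j : Fin t, i ≤ j → p j ≤ p i)
    (htubular : IsOfFinAddOrder (strDual t p h0)) :
    { v : StringGroup t p |
        v ∈ AddSubgroup.closure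
          {(3 : ℤ) • strGen t p ⟨0, h0⟩, strDual t p h0} ∧
        v ∈ AddSubmonoid.closure (Set.range (strGen t p)) } =
      ↑(AddSubmonoid.closure
        { w : StringGroup t p |
            (∃ j : ℤ, w = (3 : ℤ) • strGen t p ⟨0, h0⟩ + j • strDual t p h0) ∧
            w ∈ AddSubmonoid.closure (Set.range (strGen t p)) }) := by
  obtain ⟨f, hf, hd⟩ := str_deg t p h0 hw
  have hdeg : ∑ i, 1 / (p i : ℚ) = (t : ℚ) - 2 := by
    obtain ⟨m, hm, hm0⟩ := isOfFinAddOrder_iff_nsmul_eq_zero.1 htubular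
    have := congrArg f hm0
    rw [map_nsmul, map_zero, hd, nsmul_eq_mul] at this
    rcases mul_eq_zero.1 this with h | h
    · have : m = 0 := by exact_mod_cast h
      omega
    · linarith
  clear hd hf f htubular
  have ht4 : t ≤ 4 := by
    have : ∑ i, 1 / (p i : ℚ) ≤ ∑ i : Fin t, (1 / 2 : ℚ) := by
      refine Finset.sum_le_sum fun i _ => ?_
      have : (2 : ℚ) ≤ p i := by exact_mod_cast hw i
      exact one_div_le_one_div_of_le (by norm_num) this
    rw [hdeg] at this
    simp at this
    have : (t : ℚ) ≤ 4 := by linarith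
    exact_mod_cast this
  have ht3 : 2 < t := by
    have : 0 < ∑ i, 1 / (p i : ℚ) := by
      refine Finset.sum_pos (fun i _ => ?_) ⟨⟨0, h0⟩, Finset.mem_univ _⟩
      have := hw i
      positivity
    rw [hdeg] at this
    have : (2 : ℚ) < t := by linarith
    exact_mod_cast this
  have hg : ∀ i, strGen t p i ∈ AddSubmonoid.closure (Set.range (strGen t p)) :=
    fun i => AddSubmonoid.subset_closure ⟨i, rfl⟩
  have hr := str_rel t p h0
  interval_cases t
  · have hz : (⟨0, h0⟩ : Fin 3) = 0 := rfl
    have hr1 := hr 1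
    have hr2 := hr 2
    have hD : strDual 3 p h0 = (p 0 : ℤ) • strGen 3 p 0
        - (strGen 3 p 0 + strGen 3 p 1 + strGen 3 p 2) := by
      simp [strDual, strCan, Fin.sum_univ_three]
    have := str_arith3 (p 0) (p 1) (p 2) (hw 2) (hsorted 1 2 (by decide)) (hsorted 0 1 (by decide))
      (by rw [Fin.sum_univ_three] at hdeg; rw [hdeg]; norm_num)
    rcases this with ⟨ha, hb, hc⟩ | ⟨ha, hb, hc⟩ | ⟨ha, hb, hc⟩
    · rw [hz, ha] at hr1 hr2
      rw [hb] at hr1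
      rw [hc] at hr2
      rw [ha] at hD
      push_cast at hr1 hr2 hD
      refine str_final 3 p h0 hw hdeg 3 ?_ ?_ ?_ ?_
      · rw [hD]
        linear_combination (norm := module) - hr1 - hr2
      · rw [hD, hz]
        convert add_mem (add_mem (hg 0) (hg 1)) (hg 2) using 1
        linear_combination (norm := module) - hr1 - hr2
      · rw [hD, hz]
        convert nsmul_mem (hg 0) 3 using 1
        linear_combination (norm := module) - hr1 - hr2
      · intro n a j h1 h2
        obtain ⟨k0, hk0⟩ := h2 0
        obtain ⟨k1, hk1⟩ := h2 1
        obtain ⟨k2, hk2⟩ := h2 2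
        simp only [hz, Fin.sum_univ_three, ha, hb, hc, Fin.isValue, if_true, one_ne_zero,
          Fin.reduceEq, if_false] at h1 hk0 hk1 hk2
        have h1' : (n 0 + n 1 + n 2 : ℤ) = 3 * a := by
          have : ((n 0 + n 1 + n 2 : ℤ) : ℚ) = ((3 * a : ℤ) : ℚ) := by
            push_cast at h1 ⊢
            linarith
          exact_mod_cast this
        push_cast at hk0 hk1 hk2
        have hj : j % 3 = 0 ∨ j % 3 = 1 ∨ j % 3 = 2 := by omega
        rcases hj with hj | hj | hj
        · exact ⟨0, 0, by omega, (j - 0) / 3, by omega⟩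
        · exact ⟨2, 0, by omega, (j - 4) / 3, by omega⟩
        · exact ⟨1, 0, by omega, (j - 2) / 3, by omega⟩
    · rw [hz, ha] at hr1 hr2
      rw [hb] at hr1
      rw [hc] at hr2
      rw [ha] at hD
      push_cast at hr1 hr2 hD
      refine str_final 3 p h0 hw hdeg 4 ?_ ?_ ?_ ?_
      · rw [hD]
        linear_combination (norm := module) - hr1 - (2 : ℤ) • hr2
      · rw [hD, hz]
        convert add_mem (hg 0) (nsmul_mem (hg 1) 2) using 1
        linear_combination (norm := module) - hr1 - hr2
      · rw [hD, hz]
        convert add_mem (hg 1) (hg 2) using 1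
        linear_combination (norm := module) - hr1 - (2 : ℤ) • hr2
      · intro n a j h1 h2
        obtain ⟨k0, hk0⟩ := h2 0
        obtain ⟨k1, hk1⟩ := h2 1
        obtain ⟨k2, hk2⟩ := h2 2
        simp only [hz, Fin.sum_univ_three, ha, hb, hc, Fin.isValue, if_true, one_ne_zero,
          Fin.reduceEq, if_false] at h1 hk0 hk1 hk2
        have h1' : (n 0 + n 1 + 2 * n 2 : ℤ) = 3 * a := by
          have : ((n 0 + n 1 + 2 * n 2 : ℤ) : ℚ) = ((3 * a : ℤ) : ℚ) := by
            push_cast at h1 ⊢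
            linarith
          exact_mod_cast this
        push_cast at hk0 hk1 hk2
        have hj : j % 4 = 0 ∨ j % 4 = 1 ∨ j % 4 = 2 ∨ j % 4 = 3 := by omega
        rcases hj with hj | hj | hj | hj
        · exact ⟨0, 0, by omega, (j - 0) / 4, by omega⟩
        · exact ⟨1, 1, by omega, (j - 5) / 4, by omega⟩
        · exact ⟨1, 0, by omega, (j - 2) / 4, by omega⟩
        · exact ⟨0, 1, by omega, (j - 3) / 4, by omega⟩
    · rw [hz, ha] at hr1 hr2
      rw [hb] at hr1
      rw [hc] at hr2
      rw [ha] at hD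
      push_cast at hr1 hr2 hD
      refine str_final 3 p h0 hw hdeg 6 ?_ ?_ ?_ ?_
      · rw [hD]
        linear_combination (norm := module) - (2 : ℤ) • hr1 - (3 : ℤ) • hr2
      · rw [hD, hz]
        convert add_mem (hg 0) (hg 1) using 1
        linear_combination (norm := module) - hr1 - hr2
      · rw [hD, hz]
        convert hg 2 using 1
        linear_combination (norm := module) - hr1 - (2 : ℤ) • hr2
      · intro n a j h1 h2
        obtain ⟨k0, hk0⟩ := h2 0
        obtain ⟨k1, hk1⟩ := h2 1
        obtain ⟨k2, hk2⟩ := h2 2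
        simp only [hz, Fin.sum_univ_three, ha, hb, hc, Fin.isValue, if_true, one_ne_zero,
          Fin.reduceEq, if_false] at h1 hk0 hk1 hk2
        have h1' : (n 0 + 2 * n 1 + 3 * n 2 : ℤ) = 3 * a := by
          have : ((n 0 + 2 * n 1 + 3 * n 2 : ℤ) : ℚ) = ((3 * a : ℤ) : ℚ) := by
            push_cast at h1 ⊢
            linarith
          exact_mod_cast this
        push_cast at hk0 hk1 hk2
        have hj : j % 6 = 0 ∨ j % 6 = 1 ∨ j % 6 = 2 ∨ j % 6 = 3 ∨ j % 6 = 4 ∨ j % 6 = 5 := by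
          omega
        rcases hj with hj | hj | hj | hj | hj | hj
        · exact ⟨0, 0, by omega, (j - 0) / 6, by omega⟩
        · exact ⟨2, 1, by omega, (j - 7) / 6, by omega⟩
        · exact ⟨1, 0, by omega, (j - 2) / 6, by omega⟩
        · exact ⟨0, 1, by omega, (j - 3) / 6, by omega⟩
        · exact ⟨2, 0, by omega, (j - 4) / 6, by omega⟩
        · exact ⟨1, 1, by omega, (j - 5) / 6, by omega⟩
  · have hz : (⟨0, h0⟩ : Fin 4) = 0 := rfl
    have hle : ∀ i, 1 / (p i : ℚ) ≤ 1 / 2 := fun i => by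
      have : (2 : ℚ) ≤ p i := by exact_mod_cast hw i
      exact one_div_le_one_div_of_le (by norm_num) this
    have hp : ∀ i, p i = 2 := by
      have hs := hdeg
      rw [Fin.sum_univ_four] at hs
      push_cast at hs
      have l0 := hle 0
      have l1 := hle 1
      have l2 := hle 2
      have l3 := hle 3
      have : ∀ i, 1 / (p i : ℚ) = 1 / 2 := by
        intro i
        fin_cases i <;> simp only [Fin.zero_eta, Fin.mk_one, Fin.reduceFinMk] <;> linarith
      intro i
      have h := this i
      rw [one_div, one_div, inv_inj] at h
      exact_mod_cast h
    have hr1 := hr 1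
    have hr2 := hr 2
    have hr3 := hr 3
    have hD : strDual 4 p h0 = (4 : ℤ) • strGen 4 p 0
        - (strGen 4 p 0 + strGen 4 p 1 + strGen 4 p 2 + strGen 4 p 3) := by
      simp only [strDual, strCan, Fin.sum_univ_four, hp, hz]
      push_cast
      module
    rw [hz, hp, hp] at hr1 hr2 hr3
    push_cast at hr1 hr2 hr3
    refine str_final 4 p h0 hw hdeg 2 ?_ ?_ ?_ ?_
    · rw [hD]
      linear_combination (norm := module) - hr1 - hr2 - hr3
    · rw [hD, hz]
      convert nsmul_mem (hg 0) 3 using 1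
      linear_combination (norm := module) - hr1 - hr2 - hr3
    · rw [hD, hz]
      convert add_mem (add_mem (hg 1) (hg 2)) (hg 3) using 1
      linear_combination (norm := module) - (2 : ℤ) • hr1 - (2 : ℤ) • hr2 - (2 : ℤ) • hr3
    · intro n a j h1 h2
      obtain ⟨k0, hk0⟩ := h2 0
      obtain ⟨k1, hk1⟩ := h2 1
      obtain ⟨k2, hk2⟩ := h2 2
      obtain ⟨k3, hk3⟩ := h2 3
      simp only [hz, Fin.sum_univ_four, hp, Fin.isValue, if_true, one_ne_zero,
        Fin.reduceEq, if_false] at h1 hk0 hk1 hk2 hk3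
      have h1' : (n 0 + n 1 + n 2 + n 3 : ℤ) = 3 * a := by
        have : ((n 0 + n 1 + n 2 + n 3 : ℤ) : ℚ) = ((3 * a : ℤ) : ℚ) := by
          push_cast at h1 ⊢
          linarith
        exact_mod_cast this
      push_cast at hk0 hk1 hk2 hk3
      have hj : j % 2 = 0 ∨ j % 2 = 1 := by omega
      rcases hj with hj | hj
      · exact ⟨0, 0, by omega, (j - 0) / 2, by omega⟩
      · exact ⟨0, 1, by omega, (j - 3) / 2, by omega⟩
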